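/- Under Assumption (A) (p/n → γ ∈ (0,1)) and assuming C^{−1} ≤ A_{kk}² ≤ C for all k for a constant C ≥ 1 independent of n, there exists a constant c₀ ∈ (0,∞), independent of n, such that E[Z̃_{i+1}⁴] ≤ c₀ n^{−2} for all 0 ≤ i ≤ p−1 and all sufficiently large n. -/

import Mathlib

open MeasureTheory ProbabilityTheory Matrix Filter Topology

noncomputable section

/-- The standard Gaussian measure on `ℝ^d` (modeled on `Fin d → ℝ`). -/
def gaussianPi (d : ℕ) : Measure (Fin d → ℝ) :=
  Measure.pi fun _ => gaussianReal 0 1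

/-- The Euclidean norm on `Fin n → ℝ`. -/
def euclidNorm {n : ℕ} (x : Fin n → ℝ) : ℝ :=
  Real.sqrt (∑ j, x j ^ 2)

/-- The uniform distribution on the unit sphere `S^{n-1} ⊆ ℝ^n`, realized as the law of a
normalized standard Gaussian vector. -/
def uniformSphere (n : ℕ) : Measure (Fin n → ℝ) :=
  (gaussianPi n).map fun x => (euclidNorm x)⁻¹ • x

/-- The joint law of `p` independent uniform random directions `u_1, …, u_p` on `S^{n-1}`. -/
def sphereLaw (n p : ℕ) : Measure (Fin p → Fin n → ℝ) :=
  Measure.pi fun _ => uniformSphere n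

/-- The `(i+1)`-st sample vector `u_{i+1}` (junk value `0` if `i ≥ p`). -/
def uVec {n p : ℕ} (ω : Fin p → Fin n → ℝ) (i : ℕ) : Fin n → ℝ :=
  if h : i < p then ω ⟨i, h⟩ else 0

/-- The matrix `B_{(i)} = (b_1, …, b_i)ᵀ` with rows `b_j = A u_j`. -/
def rowMat {n p : ℕ} (A : Matrix (Fin n) (Fin n) ℝ) (ω : Fin p → Fin n → ℝ) (i : ℕ) :
    Matrix (Fin i) (Fin n) ℝ :=
  Matrix.of fun k j => A.mulVec (uVec ω (k : ℕ)) j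

/-- The projection matrix `P_i = I_n − B_{(i)}ᵀ (B_{(i)} B_{(i)}ᵀ)⁻¹ B_{(i)}` (with `P_0 = I_n`). -/
def projMat {n p : ℕ} (A : Matrix (Fin n) (Fin n) ℝ) (ω : Fin p → Fin n → ℝ) (i : ℕ) :
    Matrix (Fin n) (Fin n) ℝ :=
  1 - (rowMat A ω i)ᵀ * (rowMat A ω i * (rowMat A ω i)ᵀ)⁻¹ * rowMat A ω i

/-- The entrywise expectation `E[P_i]` of the projection matrix `P_i`. -/
def meanProj (n p : ℕ) (A : Matrix (Fin n) (Fin n) ℝ) (i : ℕ) :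
    Matrix (Fin n) (Fin n) ℝ :=
  Matrix.of fun k l => ∫ ω, projMat A ω i k l ∂(sphereLaw n p)

/-- `T_i = tr(A² E[P_i])`. -/
def Tstat (n p : ℕ) (A : Matrix (Fin n) (Fin n) ℝ) (i : ℕ) : ℝ :=
  Matrix.trace (A * A * meanProj n p A i)

/-- `Q_i = A P_i A / T_i`. -/
def Qmat {n p : ℕ} (A : Matrix (Fin n) (Fin n) ℝ) (ω : Fin p → Fin n → ℝ) (i : ℕ) :
    Matrix (Fin n) (Fin n) ℝ :=
  (Tstat n p A i)⁻¹ • (A * projMat A ω i * A)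

/-- `Z̃_{i+1} = n u_{i+1}ᵀ Q_i u_{i+1} − 1`. -/
def Ztil {n p : ℕ} (A : Matrix (Fin n) (Fin n) ℝ) (ω : Fin p → Fin n → ℝ) (i : ℕ) : ℝ :=
  (n : ℝ) * (uVec ω i ⬝ᵥ (Qmat A ω i).mulVec (uVec ω i)) - 1

/-- The variance `Var(f) = E[(f − E f)²]` of a real random variable `f` under `μ`. -/
def varInt {α : Type*} [MeasurableSpace α] (μ : Measure α) (f : α → ℝ) : ℝ :=
  ∫ ω, (f ω - ∫ ω', f ω' ∂μ) ^ 2 ∂μ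

end



theorem integrable_of_bdd {α : Type*} [MeasurableSpace α] {μ : Measure α} [IsFiniteMeasure μ]
    {f : α → ℝ} (hf : Measurable f) {K : ℝ} (hK : ∀ x, |f x| ≤ K) : Integrable f μ :=
  Integrable.of_bound hf.aestronglyMeasurable K (Eventually.of_forall hK)

theorem bd_step {α β : Type*} [MeasurableSpace α] [MeasurableSpace β] (μ : Measure α)
    [IsProbabilityMeasure μ] (ν : Measure β) [IsProbabilityMeasure ν]
    (f : α × β → ℝ) (hf : Measurable f) (K : ℝ) (hK : ∀ x, |f x| ≤ K) (c : ℝ)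
    (hc : ∀ a a' b, |f (a, b) - f (a', b)| ≤ c) (g : β → ℝ) (hg : g = fun b => ∫ a, f (a, b) ∂μ)
    (m : ℝ) (hm : m = ∫ z, f z ∂(μ.prod ν)) :
    m = ∫ b, g b ∂ν ∧
    (∫ z, (f z - m) ^ 2 ∂(μ.prod ν) ≤ (∫ b, (g b - m) ^ 2 ∂ν) + c ^ 2) ∧
    (∫ z, (f z - m) ^ 4 ∂(μ.prod ν) ≤
      (∫ b, (g b - m) ^ 4 ∂ν) + 8 * c ^ 2 * (∫ b, (g b - m) ^ 2 ∂ν) + 3 * c ^ 4) := by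
  have hfi : Integrable f (μ.prod ν) := integrable_of_bdd hf hK
  have hmeq : m = ∫ b, g b ∂ν := by rw [hm, integral_prod_symm _ hfi, hg]
  have hgm : Measurable g := by
    rw [hg]
    exact (hf.stronglyMeasurable.integral_prod_left').measurable
  have hslice : ∀ b, Integrable (fun a => f (a, b)) μ := fun b =>
    integrable_of_bdd (hf.comp (by fun_prop)) (fun a => hK (a, b))
  have hgK : ∀ b, |g b| ≤ K := by
    intro b
    rw [hg]
    have := norm_integral_le_of_norm_le_const (μ := μ) (f := fun a => f (a, b)) (C := K)
      (Eventually.of_forall fun a => hK (a, b))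
    simpa using this
  have hD : ∀ a b, |f (a, b) - g b| ≤ c := by
    intro a b
    have h1 : f (a, b) - g b = ∫ a', (f (a, b) - f (a', b)) ∂μ := by
      rw [integral_sub (integrable_const _) (hslice b), hg]; simp
    rw [h1]
    have := norm_integral_le_of_norm_le_const (μ := μ) (f := fun a' => f (a, b) - f (a', b)) (C := c)
      (Eventually.of_forall fun a' => hc a a' b)
    simpa using this
  have hmK : |m| ≤ K := by
    rw [hm]
    have := norm_integral_le_of_norm_le_const (μ := μ.prod ν) (f := f) (C := K)
      (Eventually.of_forall fun a => hK a)
    simpa using this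
  have hfm : ∀ z, |f z - m| ≤ 2 * K := fun z => by
    have := hK z; rw [abs_le] at *; constructor <;> linarith
  have hgmb : ∀ b, |g b - m| ≤ 2 * K := fun b => by
    have := hgK b; rw [abs_le] at *; constructor <;> linarith
  have hpow : ∀ k : ℕ, Integrable (fun z => (f z - m) ^ k) (μ.prod ν) := fun k =>
    integrable_of_bdd ((hf.sub_const m).pow_const k) (K := (2 * K) ^ k) fun z => by
      rw [abs_pow]; exact pow_le_pow_left₀ (abs_nonneg _) (hfm z) k
  have hgpow : ∀ k : ℕ, Integrable (fun b => (g b - m) ^ k) ν := fun k =>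
    integrable_of_bdd ((hgm.sub_const m).pow_const k) (K := (2 * K) ^ k) fun z => by
      rw [abs_pow]; exact pow_le_pow_left₀ (abs_nonneg _) (hgmb z) k
  have hDi : ∀ b, Integrable (fun a => f (a, b) - g b) μ := fun b =>
    (hslice b).sub (integrable_const _)
  have hD0 : ∀ b, ∫ a, (f (a, b) - g b) ∂μ = 0 := fun b => by
    rw [integral_sub (hslice b) (integrable_const _), hg]; simp
  refine ⟨hmeq, ?_, ?_⟩
  · rw [integral_prod_symm _ (hpow 2)]
    have hinner : ∀ b, ∫ a, (f (a, b) - m) ^ 2 ∂μ ≤ (g b - m) ^ 2 + c ^ 2 := by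
      intro b
      have : ∫ a, (f (a, b) - m) ^ 2 ∂μ ≤
          ∫ a, ((g b - m) ^ 2 + c ^ 2 + (2 * (g b - m)) * (f (a, b) - g b)) ∂μ := by
        apply integral_mono_of_nonneg (Eventually.of_forall fun a => by positivity)
        · exact (integrable_const _).add ((hDi b).const_mul _)
        · refine Eventually.of_forall fun a => ?_
          have := sq_le_sq' (abs_le.1 (hD a b)).1 (abs_le.1 (hD a b)).2
          simp only
          nlinarith
      rwa [integral_add (integrable_const _) ((hDi b).const_mul _), integral_const_mul, hD0,
        integral_const, mul_zero, add_zero, probReal_univ, one_smul] at this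
    calc _ ≤ ∫ b, ((g b - m) ^ 2 + c ^ 2) ∂ν := by
          apply integral_mono_of_nonneg _ ((hgpow 2).add (integrable_const _))
          · exact Eventually.of_forall hinner
          · exact Eventually.of_forall fun b => integral_nonneg fun a => by positivity
      _ = _ := by rw [integral_add (hgpow 2) (integrable_const _)]; simp
  · rw [integral_prod_symm _ (hpow 4)]
    have hinner : ∀ b, ∫ a, (f (a, b) - m) ^ 4 ∂μ ≤
        (g b - m) ^ 4 + 8 * c ^ 2 * (g b - m) ^ 2 + 3 * c ^ 4 := by
      intro b
      have : ∫ a, (f (a, b) - m) ^ 4 ∂μ ≤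
          ∫ a, ((g b - m) ^ 4 + 8 * c ^ 2 * (g b - m) ^ 2 + 3 * c ^ 4
            + (4 * (g b - m) ^ 3) * (f (a, b) - g b)) ∂μ := by
        apply integral_mono_of_nonneg (Eventually.of_forall fun a => by positivity)
        · exact (integrable_const _).add ((hDi b).const_mul _)
        · refine Eventually.of_forall fun a => ?_
          have h2 := sq_le_sq' (abs_le.1 (hD a b)).1 (abs_le.1 (hD a b)).2
          simp only
          generalize hd : f (a, b) - g b = D at *
          have e : f (a, b) - m = D + (g b - m) := by rw [← hd]; ring
          rw [e]
          generalize g b - m = d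
          have h4 : D ^ 4 ≤ c ^ 4 := by nlinarith [sq_nonneg D, sq_nonneg c]
          have h22 : D ^ 2 * d ^ 2 ≤ c ^ 2 * d ^ 2 := mul_le_mul_of_nonneg_right h2 (sq_nonneg d)
          nlinarith [sq_nonneg (D * (D - d))]
      rwa [integral_add (integrable_const _) ((hDi b).const_mul _), integral_const_mul, hD0,
        integral_const, mul_zero, add_zero, probReal_univ, one_smul] at this
    calc _ ≤ ∫ b, ((g b - m) ^ 4 + 8 * c ^ 2 * (g b - m) ^ 2 + 3 * c ^ 4) ∂ν := by
          apply integral_mono_of_nonneg _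
            (((hgpow 4).add ((hgpow 2).const_mul _)).add (integrable_const _))
          · exact Eventually.of_forall hinner
          · exact Eventually.of_forall fun b => integral_nonneg fun a => by positivity
      _ = _ := by
        have hsum : Integrable (fun b => (g b - m) ^ 4 + 8 * c ^ 2 * (g b - m) ^ 2) ν :=
          (hgpow 4).add ((hgpow 2).const_mul _)
        rw [integral_add hsum (integrable_const _),
          integral_add (hgpow 4) ((hgpow 2).const_mul _), integral_const_mul]; simp

theorem bd_moments {E : Type*} [MeasurableSpace E] (μ : Measure E) [IsProbabilityMeasure μ]
    (c : ℝ) (k : ℕ) :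
    ∀ (f : (Fin k → E) → ℝ) (_ : Measurable f) (K : ℝ) (_ : ∀ x, |f x| ≤ K)
    (_ : ∀ x j y, |f (Function.update x j y) - f x| ≤ c),
    (∫ x, (f x - ∫ x', f x' ∂(Measure.pi fun _ => μ)) ^ 2 ∂(Measure.pi fun _ => μ)
      ≤ k * c ^ 2) ∧
    (∫ x, (f x - ∫ x', f x' ∂(Measure.pi fun _ => μ)) ^ 4 ∂(Measure.pi fun _ => μ)
      ≤ 4 * c ^ 4 * k ^ 2) := by
  induction k with
  | zero =>
    intro f hf K hK hc
    have : ∀ x, f x = f default := fun x => by rw [Subsingleton.elim x default]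
    simp [this]
  | succ k ih =>
    intro f hf K hK hc
    have hmp := measurePreserving_piFinSuccAbove (fun _ : Fin (k + 1) => μ) 0
    set e := MeasurableEquiv.piFinSuccAbove (fun _ : Fin (k + 1) => E) 0
    have hint : ∀ h : (Fin (k + 1) → E) → ℝ, ∫ x, h x ∂(Measure.pi fun _ => μ) =
        ∫ z, h (e.symm z) ∂(μ.prod (Measure.pi fun _ : Fin k => μ)) := by
      intro h
      rw [← hmp.map_eq, integral_map_equiv]
      simp
    have hs : ∀ a (b : Fin k → E), e.symm (a, b) = Fin.cons a b := by
      intro a b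
      simp [e, MeasurableEquiv.piFinSuccAbove]
      rfl
    rw [hint f]
    rw [hint, hint]
    have hF : Measurable fun z => f (e.symm z) := hf.comp e.symm.measurable
    obtain ⟨h1, h2, h3⟩ := bd_step μ (Measure.pi fun _ : Fin k => μ) (fun z => f (e.symm z)) hF K
      (fun z => hK _) c (by
        intro a a' b
        rw [hs, hs]
        have := hc (Fin.cons a' b) 0 a
        rwa [Fin.update_cons_zero] at this) _ rfl _ rfl
    obtain ⟨i1, i2⟩ := ih (fun b => ∫ a, f (e.symm (a, b)) ∂μ)
      (hF.stronglyMeasurable.integral_prod_left').measurable K (by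
        intro b
        have := norm_integral_le_of_norm_le_const (μ := μ) (f := fun a => f (e.symm (a, b)))
          (C := K) (Eventually.of_forall fun a => hK _)
        simpa using this) (by
        intro b j y
        have hi : ∀ b, Integrable (fun a => f (e.symm (a, b))) μ := fun b =>
          integrable_of_bdd (hF.comp (by fun_prop)) (fun a => hK _)
        rw [← integral_sub (hi _) (hi _)]
        have := norm_integral_le_of_norm_le_const (μ := μ)
          (f := fun a => f (e.symm (a, Function.update b j y)) - f (e.symm (a, b)))
          (C := c) (Eventually.of_forall fun a => by
            rw [hs, hs, Fin.cons_update]; exact hc _ _ _)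
        simpa using this)
    rw [← h1] at i1 i2
    push_cast
    constructor
    · linarith
    · have : 0 ≤ c ^ 2 := sq_nonneg c
      have h5 := mul_le_mul_of_nonneg_left i1 (by positivity : 0 ≤ 8 * c ^ 2)
      nlinarith [sq_nonneg (c ^ 2)]


theorem memLp_pow_int {Ω : Type*} [MeasurableSpace Ω] {μ : Measure Ω} [IsProbabilityMeasure μ]
    {X : Ω → ℝ} (h : MemLp X 4 μ) (k : ℕ) (hk : k ≤ 4) : Integrable (fun ω => X ω ^ k) μ := by
  have h1 : MemLp X (k : ENNReal) μ := h.mono_exponent (by exact_mod_cast hk)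
  have h2 := h1.integrable_norm_pow'
  rw [← integrable_norm_iff (f := fun ω => X ω ^ k) (h.1.pow k)]
  simpa using h2

theorem four_add {Ω : Type*} [MeasurableSpace Ω] {μ : Measure Ω} [IsProbabilityMeasure μ]
    {S Y : Ω → ℝ} (hI : S ⟂ᵢ[μ] Y) (hS : MemLp S 4 μ) (hY : MemLp Y 4 μ)
    (hS0 : ∫ ω, S ω ∂μ = 0) (hY0 : ∫ ω, Y ω ∂μ = 0) :
    ∫ ω, (Y ω + S ω) ∂μ = 0 ∧
    ∫ ω, (Y ω + S ω) ^ 2 ∂μ = ∫ ω, Y ω ^ 2 ∂μ + ∫ ω, S ω ^ 2 ∂μ ∧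
    ∫ ω, (Y ω + S ω) ^ 4 ∂μ = ∫ ω, Y ω ^ 4 ∂μ + 6 * ((∫ ω, S ω ^ 2 ∂μ) * (∫ ω, Y ω ^ 2 ∂μ))
      + ∫ ω, S ω ^ 4 ∂μ := by
  have hiS := memLp_pow_int hS
  have hiY := memLp_pow_int hY
  have hIjk : ∀ j k : ℕ, (fun ω => S ω ^ j) ⟂ᵢ[μ] (fun ω => Y ω ^ k) := fun j k =>
    hI.comp (φ := fun x : ℝ => x ^ j) (ψ := fun x : ℝ => x ^ k) (by fun_prop) (by fun_prop)
  have hint : ∀ j k : ℕ, j ≤ 4 → k ≤ 4 → Integrable (fun ω => S ω ^ j * Y ω ^ k) μ :=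
    fun j k hj hk => (hIjk j k).integrable_mul (hiS j hj) (hiY k hk)
  have hprod : ∀ j k : ℕ, ∫ ω, S ω ^ j * Y ω ^ k ∂μ = (∫ ω, S ω ^ j ∂μ) * ∫ ω, Y ω ^ k ∂μ :=
    fun j k => (hIjk j k).integral_fun_mul_eq_mul_integral (hS.1.pow j) (hY.1.pow k)
  have hS1 : ∫ ω, S ω ^ 1 ∂μ = 0 := by simpa using hS0
  have hY1 : ∫ ω, Y ω ^ 1 ∂μ = 0 := by simpa using hY0
  refine ⟨?_, ?_, ?_⟩
  · have e1 := hiS 1 (by norm_num)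
    have e2 := hiY 1 (by norm_num)
    simp only [pow_one] at e1 e2
    rw [integral_add e2 e1, hS0, hY0, add_zero]
  · have : ∀ ω, (Y ω + S ω) ^ 2 = Y ω ^ 2 + S ω ^ 2 + 2 * (S ω ^ 1 * Y ω ^ 1) := fun ω => by ring
    simp only [this]
    have ha : Integrable (fun ω => Y ω ^ 2 + S ω ^ 2) μ :=
      (hiY 2 (by norm_num)).add (hiS 2 (by norm_num))
    rw [integral_add ha ((hint 1 1 (by norm_num) (by norm_num)).const_mul 2),
      integral_add (hiY 2 (by norm_num)) (hiS 2 (by norm_num)), integral_const_mul, hprod, hS1]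
    ring
  · have : ∀ ω, (Y ω + S ω) ^ 4 = Y ω ^ 4 + 6 * (S ω ^ 2 * Y ω ^ 2) + S ω ^ 4
        + 4 * (S ω ^ 1 * Y ω ^ 3) + 4 * (S ω ^ 3 * Y ω ^ 1) := fun ω => by ring
    simp only [this]
    have i1 := (hint 2 2 (by norm_num) (by norm_num)).const_mul 6
    have i2 := (hint 1 3 (by norm_num) (by norm_num)).const_mul 4
    have i3 := (hint 3 1 (by norm_num) (by norm_num)).const_mul 4
    have ha : Integrable (fun ω => Y ω ^ 4 + 6 * (S ω ^ 2 * Y ω ^ 2)) μ :=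
      (hiY 4 le_rfl).add i1
    have hb : Integrable (fun ω => Y ω ^ 4 + 6 * (S ω ^ 2 * Y ω ^ 2) + S ω ^ 4) μ :=
      ha.add (hiS 4 le_rfl)
    have hc : Integrable (fun ω => Y ω ^ 4 + 6 * (S ω ^ 2 * Y ω ^ 2) + S ω ^ 4
        + 4 * (S ω ^ 1 * Y ω ^ 3)) μ := hb.add i2
    rw [integral_add hc i3, integral_add hb i2, integral_add ha (hiS 4 le_rfl),
      integral_add (hiY 4 le_rfl) i1, integral_const_mul, integral_const_mul, integral_const_mul,
      hprod, hprod, hprod, hS1, hY1]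
    ring

theorem four_sum {Ω ι : Type*} [MeasurableSpace Ω] {μ : Measure Ω} [IsProbabilityMeasure μ]
    [DecidableEq ι] {Y : ι → Ω → ℝ} (hind : iIndepFun Y μ) (hm : ∀ i, Measurable (Y i))
    (h4 : ∀ i, MemLp (Y i) 4 μ) (h0 : ∀ i, ∫ ω, Y i ω ∂μ = 0) (a b : ℝ) (ha : 0 ≤ a)
    (h2a : ∀ i, ∫ ω, Y i ω ^ 2 ∂μ ≤ a) (h4b : ∀ i, ∫ ω, Y i ω ^ 4 ∂μ ≤ b) (s : Finset ι) :
    ∫ ω, (∑ i ∈ s, Y i ω) ∂μ = 0 ∧ ∫ ω, (∑ i ∈ s, Y i ω) ^ 2 ∂μ ≤ s.card * a ∧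
    ∫ ω, (∑ i ∈ s, Y i ω) ^ 4 ∂μ ≤ 3 * a ^ 2 * s.card ^ 2 + b * s.card := by
  induction s using Finset.induction_on with
  | empty => simp
  | insert i s hi ih =>
    obtain ⟨i0, i2, i4⟩ := ih
    have hS4 : MemLp (fun ω => ∑ j ∈ s, Y j ω) 4 μ := memLp_finsetSum s fun j _ => h4 j
    have hI : (fun ω => ∑ j ∈ s, Y j ω) ⟂ᵢ[μ] Y i := by
      have := hind.indepFun_finsetSum_of_notMem hm hi
      convert this using 1
      ext ω; simp
    simp only [Finset.sum_insert hi, Finset.card_insert_of_notMem hi]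
    obtain ⟨j0, j2, j4⟩ := four_add hI hS4 (h4 i) i0 (h0 i)
    refine ⟨j0, ?_, ?_⟩
    · rw [j2]; push_cast; linarith [h2a i]
    · rw [j4]; push_cast
      have hp : (∫ ω, (∑ i ∈ s, Y i ω) ^ 2 ∂μ) * (∫ ω, Y i ω ^ 2 ∂μ) ≤ (s.card * a) * a :=
        mul_le_mul i2 (h2a i) (integral_nonneg fun _ => by positivity) (by positivity)
      nlinarith [h4b i, sq_nonneg a]

/-- The standard Gaussian measure is invariant under orthonormal change of basis. -/
theorem gaussian_rot {n : ℕ} (b : OrthonormalBasis (Fin n) ℝ (EuclideanSpace ℝ (Fin n))) :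
    (Measure.pi fun _ : Fin n => gaussianReal 0 1).map
      (fun x => WithLp.ofLp (∑ i, x i • b i)) = Measure.pi fun _ : Fin n => gaussianReal 0 1 := by
  have h := (stdGaussian_eq_map_pi_orthonormalBasis b).symm
  rw [← map_pi_eq_stdGaussian] at h
  have h2 := congrArg (fun μ => Measure.map (WithLp.ofLp) μ) h
  simp only at h2
  rw [Measure.map_map (by fun_prop) (by fun_prop), Measure.map_map (by fun_prop) (by fun_prop)] at h2
  have e : (WithLp.ofLp ∘ (WithLp.toLp 2) : (Fin n → ℝ) → (Fin n → ℝ)) = id := by ext; simp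
  rw [e, Measure.map_id] at h2
  exact h2

theorem quad_eigen {n : ℕ} {M : Matrix (Fin n) (Fin n) ℝ} (hM : M.IsHermitian) (x : Fin n → ℝ) :
    (WithLp.ofLp (∑ i, x i • hM.eigenvectorBasis i)) ⬝ᵥ
      M *ᵥ (WithLp.ofLp (∑ i, x i • hM.eigenvectorBasis i)) =
      ∑ i, hM.eigenvalues i * x i ^ 2 := by
  have h1 : M *ᵥ (WithLp.ofLp (∑ i, x i • hM.eigenvectorBasis i)) =
      WithLp.ofLp (∑ i, (hM.eigenvalues i * x i) • hM.eigenvectorBasis i) := by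
    simp only [WithLp.ofLp_sum, WithLp.ofLp_smul, Matrix.mulVec_sum, Matrix.mulVec_smul,
      hM.mulVec_eigenvectorBasis, smul_smul]
    simp only [mul_comm]
  rw [h1]
  have h2 : ∀ u v : EuclideanSpace ℝ (Fin n), u.ofLp ⬝ᵥ v.ofLp = inner ℝ u v := by
    intro u v
    simp [EuclideanSpace.inner_eq_star_dotProduct, dotProduct_comm]
  rw [h2, Orthonormal.inner_sum hM.eigenvectorBasis.orthonormal]
  simp
  exact Finset.sum_congr rfl fun i _ => by ring

theorem gauss_memLp (k : ℕ) : MemLp (fun x : ℝ => x) k (gaussianReal 0 1) :=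
  memLp_id_gaussianReal' (k : ENNReal) (by simp)

theorem gauss_pow_int (k : ℕ) : Integrable (fun x : ℝ => x ^ k) (gaussianReal 0 1) := by
  have h2 := (gauss_memLp k).integrable_norm_pow'
  rw [← integrable_norm_iff (by fun_prop)]
  simpa using h2

theorem gauss_sq : ∫ x, x ^ 2 ∂(gaussianReal 0 1) = 1 := by
  have h := variance_fun_id_gaussianReal (μ := 0) (v := 1)
  rw [variance_eq_integral (by fun_prop)] at h
  simpa using h

theorem gauss_Y_memLp : MemLp (fun x : ℝ => x ^ 2 - 1) 4 (gaussianReal 0 1) := by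
  rw [show (4 : ENNReal) = ((4 : ℕ) : ENNReal) by norm_num]
  rw [← integrable_norm_rpow_iff (by fun_prop) (by norm_num) (by norm_num)]
  have e : ∀ x : ℝ, ‖x ^ 2 - 1‖ ^ (((4 : ℕ) : ENNReal).toReal) =
      x ^ 8 - 4 * x ^ 6 + 6 * x ^ 4 - 4 * x ^ 2 + 1 := by
    intro x
    simp only [ENNReal.toReal_natCast, Real.rpow_natCast, Real.norm_eq_abs]
    rw [Even.pow_abs (by decide)]
    ring
  simp only [e]
  exact ((((gauss_pow_int 8).sub ((gauss_pow_int 6).const_mul 4)).add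
    ((gauss_pow_int 4).const_mul 6)).sub ((gauss_pow_int 2).const_mul 4)).add (integrable_const 1)

/-- Fourth moment of a centred Gaussian quadratic form. -/
theorem gauss_quad : ∃ K : ℝ, 0 ≤ K ∧ ∀ (n : ℕ) (M : Matrix (Fin n) (Fin n) ℝ) (hM : M.IsHermitian)
    (C : ℝ) (_ : ∀ i, |hM.eigenvalues i| ≤ C),
    Integrable (fun x => (x ⬝ᵥ M *ᵥ x - M.trace) ^ 4) (Measure.pi fun _ : Fin n => gaussianReal 0 1) ∧
    ∫ x, (x ⬝ᵥ M *ᵥ x - M.trace) ^ 4 ∂(Measure.pi fun _ : Fin n => gaussianReal 0 1)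
      ≤ K * C ^ 4 * n ^ 2 := by
  set m2 := ∫ x, (x ^ 2 - 1) ^ 2 ∂(gaussianReal 0 1) with hm2
  set m4 := ∫ x, (x ^ 2 - 1) ^ 4 ∂(gaussianReal 0 1) with hm4
  have hm2n : 0 ≤ m2 := integral_nonneg fun x => by positivity
  have hm4n : 0 ≤ m4 := integral_nonneg fun x => by positivity
  refine ⟨3 * m2 ^ 2 + m4, by positivity, ?_⟩
  intro n M hM C hC
  set lam := hM.eigenvalues with hlam
  set Y : Fin n → (Fin n → ℝ) → ℝ := fun i x => lam i * (x i ^ 2 - 1) with hY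
  set P := Measure.pi fun _ : Fin n => gaussianReal 0 1 with hP
  have hind : iIndepFun Y P :=
    iIndepFun_pi (X := fun i (t : ℝ) => lam i * (t ^ 2 - 1)) (fun i => by fun_prop)
  have hYm : ∀ i, Measurable (Y i) := fun i => by fun_prop
  have hY4 : ∀ i, MemLp (Y i) 4 P := fun i =>
    (gauss_Y_memLp.comp_measurePreserving (measurePreserving_eval _ i)).const_mul (lam i)
  have hY0 : ∀ i, ∫ x, Y i x ∂P = 0 := by
    intro i
    have hev := integral_comp_eval (μ := fun _ : Fin n => gaussianReal 0 1) (i := i)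
      (f := fun t : ℝ => t ^ 2 - 1) (by fun_prop)
    rw [hP, hY, integral_const_mul, hev, integral_sub (gauss_pow_int 2) (integrable_const _), gauss_sq]
    simp
  have hpw : ∀ i k, ∫ x, Y i x ^ k ∂P = lam i ^ k * ∫ t, (t ^ 2 - 1) ^ k ∂(gaussianReal 0 1) := by
    intro i k
    simp only [hY, mul_pow]
    have hev := integral_comp_eval (μ := fun _ : Fin n => gaussianReal 0 1) (i := i)
      (f := fun t : ℝ => (t ^ 2 - 1) ^ k) (by fun_prop)
    rw [hP, integral_const_mul, hev]
  have hl2 : ∀ i, lam i ^ 2 ≤ C ^ 2 := fun i => sq_le_sq' (abs_le.1 (hC i)).1 (abs_le.1 (hC i)).2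
  have hl4 : ∀ i, lam i ^ 4 ≤ C ^ 4 := fun i => by nlinarith [hl2 i, sq_nonneg (lam i), sq_nonneg C]
  have hsum := (four_sum hind hYm hY4 hY0 (C ^ 2 * m2) (C ^ 4 * m4) (by positivity)
    (fun i => by rw [hpw]; exact mul_le_mul_of_nonneg_right (hl2 i) hm2n)
    (fun i => by rw [hpw]; exact mul_le_mul_of_nonneg_right (hl4 i) hm4n) Finset.univ).2.2
  have hS4 : MemLp (fun x => ∑ j, Y j x) 4 P := memLp_finsetSum _ fun j _ => hY4 j
  have hrot := gaussian_rot hM.eigenvectorBasis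
  rw [← hP] at hrot
  have hptw : ∀ x : Fin n → ℝ, ((WithLp.ofLp (∑ i, x i • hM.eigenvectorBasis i)) ⬝ᵥ
      M *ᵥ (WithLp.ofLp (∑ i, x i • hM.eigenvectorBasis i)) - M.trace) = ∑ j, Y j x := by
    intro x
    rw [quad_eigen, hM.trace_eq_sum_eigenvalues]
    simp [hY, hlam, mul_sub]
  have hmeas : Measurable fun x : Fin n → ℝ => WithLp.ofLp (∑ i, x i • hM.eigenvectorBasis i) := by
    fun_prop
  have hmF : Measurable fun x : Fin n → ℝ => (x ⬝ᵥ M *ᵥ x - M.trace) ^ 4 := by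
    have : Continuous fun x : Fin n → ℝ => (x ⬝ᵥ M *ᵥ x - M.trace) ^ 4 := by fun_prop
    exact this.measurable
  constructor
  · rw [← hrot, integrable_map_measure hmF.aestronglyMeasurable hmeas.aemeasurable]
    simp only [Function.comp_def, hptw]
    exact memLp_pow_int hS4 4 le_rfl
  · rw [← hrot, integral_map hmeas.aemeasurable hmF.aestronglyMeasurable]
    simp only [hptw]
    refine hsum.trans ?_
    simp only [Finset.card_univ, Fintype.card_fin]
    have hn : (n : ℝ) ≤ (n : ℝ) ^ 2 := by exact_mod_cast Nat.le_self_pow (by norm_num) n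
    have := mul_le_mul_of_nonneg_left hn (by positivity : 0 ≤ C ^ 4 * m4)
    nlinarith


instance gaussianPi_prob (n : ℕ) : IsProbabilityMeasure (gaussianPi n) := by
  unfold gaussianPi; infer_instance

theorem measurable_normalize (n : ℕ) :
    Measurable fun x : Fin n → ℝ => (euclidNorm x)⁻¹ • x := by
  unfold euclidNorm
  fun_prop

instance uniformSphere_prob (n : ℕ) : IsProbabilityMeasure (uniformSphere n) :=
  Measure.isProbabilityMeasure_map (measurable_normalize n).aemeasurable

instance sphereLaw_prob (n p : ℕ) : IsProbabilityMeasure (sphereLaw n p) := by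
  unfold sphereLaw; infer_instance

theorem gaussianPi_ker_null {n : ℕ} (f : (Fin n → ℝ) →ₗ[ℝ] ℝ) (hf : f ≠ 0) :
    ∀ᵐ x ∂(gaussianPi n), f x ≠ 0 := by
  set L : StrongDual ℝ (EuclideanSpace ℝ (Fin n)) :=
    LinearMap.toContinuousLinearMap
      (f ∘ₗ (WithLp.linearEquiv 2 ℝ (Fin n → ℝ)).toLinearMap) with hL
  have hLf : ∀ x, L (WithLp.toLp 2 x) = f x := fun x => by simp [hL]
  have hL0 : L ≠ 0 := by
    intro h
    apply hf
    refine LinearMap.ext fun x => ?_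
    rw [← hLf, h]; simp
  have hmap := IsGaussian.map_eq_gaussianReal (μ := stdGaussian (EuclideanSpace ℝ (Fin n))) L
  rw [variance_dual_stdGaussian] at hmap
  have hv : (‖L‖ ^ 2).toNNReal ≠ 0 := by
    have : 0 < ‖L‖ := norm_pos_iff.2 hL0
    simp; positivity
  have hns := nullSingletonClass_gaussianReal (μ := ∫ x, L x ∂(stdGaussian _)) hv
  have h1 : (gaussianReal (∫ x, L x ∂(stdGaussian _)) (‖L‖ ^ 2).toNNReal) {0} = 0 :=
    hns.measure_singleton 0
  rw [← hmap, ← map_pi_eq_stdGaussian, Measure.map_map (by fun_prop) (by fun_prop),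
    Measure.map_apply (by fun_prop) (measurableSet_singleton 0)] at h1
  rw [ae_iff]
  have hset : {x | ¬ f x ≠ 0} = (⇑L ∘ WithLp.toLp 2) ⁻¹' {0} := by
    ext x
    change ¬ (f x ≠ 0) ↔ L (WithLp.toLp 2 x) ∈ ({0} : Set ℝ)
    rw [hLf]; simp
  rw [hset]
  exact h1

theorem uniformSphere_sub_null {n : ℕ} (W : Submodule ℝ (Fin n → ℝ)) (hW : W ≠ ⊤) :
    ∀ᵐ u ∂(uniformSphere n), u ∉ W := by
  obtain ⟨f, hf, hWf⟩ := Submodule.exists_le_ker_of_lt_top W hW.lt_top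
  have h := gaussianPi_ker_null f hf
  unfold uniformSphere
  have hcl : MeasurableSet (W : Set (Fin n → ℝ)) := W.closed_of_finiteDimensional.measurableSet
  rw [ae_map_iff (measurable_normalize n).aemeasurable (p := fun u => u ∉ W) hcl.compl]
  filter_upwards [h] with x hx hmem
  have h1 := hWf hmem
  rw [LinearMap.mem_ker, map_smul, smul_eq_mul] at h1
  rcases mul_eq_zero.1 h1 with h2 | h2
  · apply hx
    have h3 : euclidNorm x = 0 := inv_eq_zero.1 h2
    unfold euclidNorm at h3
    rw [Real.sqrt_eq_zero (Finset.sum_nonneg fun i _ => sq_nonneg _),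
      Finset.sum_eq_zero_iff_of_nonneg (fun i _ => sq_nonneg _)] at h3
    have : x = 0 := by
      ext i
      simpa using h3 i (Finset.mem_univ i)
    rw [this, map_zero]
  · exact hx h2

theorem sphereLaw_linInd (n p : ℕ) (hp : p ≤ n) :
    ∀ᵐ ω ∂(sphereLaw n p), LinearIndependent ℝ ω := by
  induction p with
  | zero => exact Eventually.of_forall fun ω => linearIndependent_empty_type
  | succ k ih =>
    have hk := ih (by omega)
    unfold sphereLaw at *
    have hmp := measurePreserving_piFinSuccAbove (fun _ : Fin (k + 1) => uniformSphere n) 0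
    set e := MeasurableEquiv.piFinSuccAbove (fun _ : Fin (k + 1) => Fin n → ℝ) 0
    have hs : ∀ a (b : Fin k → Fin n → ℝ), e.symm (a, b) = Fin.cons a b := by
      intro a b
      simp [e, MeasurableEquiv.piFinSuccAbove]
      rfl
    have hms : MeasurableSet {ω : Fin (k + 1) → Fin n → ℝ | LinearIndependent ℝ ω} :=
      isOpen_setOfPred_linearIndependent.measurableSet
    have hmp' := hmp.symm e
    rw [← hmp'.map_eq, ae_map_iff e.symm.measurable.aemeasurable hms]
    have hms' : MeasurableSet {z : (Fin n → ℝ) × (Fin k → Fin n → ℝ) |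
        LinearIndependent ℝ (e.symm z)} := e.symm.measurable hms
    have hswap : ∀ᵐ z ∂((Measure.pi fun _ : Fin k => uniformSphere n).prod (uniformSphere n)),
        LinearIndependent ℝ (e.symm z.swap) := by
      refine (Measure.ae_prod_mem_iff_ae_ae_mem (measurable_swap hms')).2 ?_
      filter_upwards [hk] with b hb
      have hW : Submodule.span ℝ (Set.range b) ≠ ⊤ := by
        intro h
        have h1 := finrank_range_le_card (R := ℝ) b
        rw [Set.finrank, h, finrank_top] at h1
        simp at h1
        omega
      filter_upwards [uniformSphere_sub_null _ hW] with a ha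
      show LinearIndependent ℝ (e.symm (a, b))
      rw [hs, linearIndependent_finCons]
      exact ⟨hb, ha⟩
    have := Measure.measurePreserving_swap
      (μ := (Measure.pi fun _ : Fin k => uniformSphere n)) (ν := uniformSphere n)
    rw [← this.map_eq, ae_map_iff measurable_swap.aemeasurable hms']
    exact hswap

theorem quad_scale {n : ℕ} (M : Matrix (Fin n) (Fin n) ℝ) (x : Fin n → ℝ) :
    x ⬝ᵥ M *ᵥ x = (x ⬝ᵥ x) *
      (((euclidNorm x)⁻¹ • x) ⬝ᵥ M *ᵥ ((euclidNorm x)⁻¹ • x)) := by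
  have hx : x ⬝ᵥ x = euclidNorm x ^ 2 := by
    unfold euclidNorm
    rw [Real.sq_sqrt (Finset.sum_nonneg fun i _ => sq_nonneg _)]
    simp [dotProduct, sq]
  by_cases h : euclidNorm x = 0
  · have : x = 0 := by
      rw [h] at hx
      simpa [dotProduct_self_eq_zero] using hx
    simp [this]
  · rw [hx, mulVec_smul, dotProduct_smul, smul_dotProduct, smul_eq_mul, smul_eq_mul]
    field_simp

theorem sphere_quad : ∃ K : ℝ, 0 ≤ K ∧ ∀ (n : ℕ) (M : Matrix (Fin n) (Fin n) ℝ)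
    (_ : M.IsHermitian) (C : ℝ) (_ : ∀ x, 0 ≤ x ⬝ᵥ M *ᵥ x) (_ : ∀ x, x ⬝ᵥ M *ᵥ x ≤ C * (x ⬝ᵥ x)),
    Integrable (fun u => (n * (u ⬝ᵥ M *ᵥ u) - M.trace) ^ 4) (uniformSphere n) ∧
    ∫ u, (n * (u ⬝ᵥ M *ᵥ u) - M.trace) ^ 4 ∂(uniformSphere n) ≤ K * C ^ 4 * n ^ 2 := by
  obtain ⟨K, hK, hG⟩ := gauss_quad
  refine ⟨16 * K, by positivity, ?_⟩
  intro n M hM C h0 hC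
  have heig : ∀ i, |hM.eigenvalues i| ≤ C := by
    intro i
    have h1 := hM.eigenvalues_eq i
    have h2 := h0 (hM.eigenvectorBasis i).ofLp
    have h3 := hC (hM.eigenvectorBasis i).ofLp
    have h4 : (hM.eigenvectorBasis i).ofLp ⬝ᵥ (hM.eigenvectorBasis i).ofLp = 1 := by
      have := hM.eigenvectorBasis.orthonormal.1 i
      have h5 := real_inner_self_eq_norm_sq (hM.eigenvectorBasis i)
      rw [this, EuclideanSpace.inner_eq_star_dotProduct] at h5
      simpa using h5
    simp only [star_trivial, RCLike.re_to_real] at h1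
    rw [h4] at h3
    rw [h1, abs_of_nonneg h2]; linarith
  have h1herm : (1 : Matrix (Fin n) (Fin n) ℝ).IsHermitian := isHermitian_one
  have heig1 : ∀ i, |h1herm.eigenvalues i| ≤ 1 := by
    intro i
    have h1 := h1herm.eigenvalues_eq i
    have h4 : (h1herm.eigenvectorBasis i).ofLp ⬝ᵥ (h1herm.eigenvectorBasis i).ofLp = 1 := by
      have := h1herm.eigenvectorBasis.orthonormal.1 i
      have h5 := real_inner_self_eq_norm_sq (h1herm.eigenvectorBasis i)
      rw [this, EuclideanSpace.inner_eq_star_dotProduct] at h5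
      simpa using h5
    simp only [star_trivial, RCLike.re_to_real, one_mulVec] at h1
    rw [h1, h4]; simp
  obtain ⟨g1, g2⟩ := hG n M hM C heig
  obtain ⟨g3, g4⟩ := hG n 1 h1herm 1 heig1
  change Integrable _ (gaussianPi n) at g1 g3
  change ∫ x, _ ∂(gaussianPi n) ≤ _ at g2 g4
  have hmF : Measurable fun x : Fin n → ℝ => (n * (x ⬝ᵥ M *ᵥ x) - M.trace) ^ 4 := by
    have : Continuous fun x : Fin n → ℝ => (n * (x ⬝ᵥ M *ᵥ x) - M.trace) ^ 4 := by fun_prop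
    exact this.measurable
  have hmn := measurable_normalize n
  have hptw : ∀ x : Fin n → ℝ,
      (n * (((euclidNorm x)⁻¹ • x) ⬝ᵥ M *ᵥ ((euclidNorm x)⁻¹ • x)) - M.trace) ^ 4 ≤
      8 * (x ⬝ᵥ M *ᵥ x - M.trace) ^ 4 +
        8 * C ^ 4 * (x ⬝ᵥ (1 : Matrix (Fin n) (Fin n) ℝ) *ᵥ x -
          (1 : Matrix (Fin n) (Fin n) ℝ).trace) ^ 4 := by
    intro x
    have e1 := quad_scale M x
    set q := ((euclidNorm x)⁻¹ • x) ⬝ᵥ M *ᵥ ((euclidNorm x)⁻¹ • x) with hq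
    have hq0 : 0 ≤ q := h0 _
    have hqC : q ^ 4 * (x ⬝ᵥ x - n) ^ 4 ≤ C ^ 4 * (x ⬝ᵥ x - n) ^ 4 := by
      by_cases hx : x = 0
      · have : q = 0 := by rw [hq, hx]; simp
        rw [this]
        have : 0 ≤ C ^ 4 * (x ⬝ᵥ x - n) ^ 4 := by positivity
        simpa using this
      · have hpos : 0 < x ⬝ᵥ x := by
          have := dotProduct_self_star_pos_iff.2 hx
          simpa using this
        have h3 := hC x
        rw [e1, mul_comm] at h3
        have : q ≤ C := le_of_mul_le_mul_right h3 hpos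
        gcongr
    simp only [one_mulVec, trace_one, Fintype.card_fin]
    have e2 : n * q - M.trace = (x ⬝ᵥ M *ᵥ x - M.trace) - q * (x ⬝ᵥ x - n) := by rw [e1]; ring
    rw [e2]
    generalize x ⬝ᵥ M *ᵥ x - M.trace = X
    have h8 : ∀ a b : ℝ, (a - b) ^ 4 ≤ 8 * a ^ 4 + 8 * b ^ 4 := by
      intro a b
      nlinarith [sq_nonneg (a + b), sq_nonneg (a - b), sq_nonneg (a ^ 2 - b ^ 2),
        mul_nonneg (sq_nonneg (a + b)) (sq_nonneg (a - b)), sq_nonneg ((a + b) ^ 2),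
        sq_nonneg (a * b), sq_nonneg ((a-b)^2)]
    have := h8 X (q * (x ⬝ᵥ x - n))
    rw [mul_pow q] at this
    linarith
  have hdom : Integrable (fun x : Fin n → ℝ => 8 * (x ⬝ᵥ M *ᵥ x - M.trace) ^ 4 +
        8 * C ^ 4 * (x ⬝ᵥ (1 : Matrix (Fin n) (Fin n) ℝ) *ᵥ x -
          (1 : Matrix (Fin n) (Fin n) ℝ).trace) ^ 4) (gaussianPi n) :=
    (g1.const_mul 8).add (g3.const_mul (8 * C ^ 4))
  unfold uniformSphere
  constructor
  · rw [integrable_map_measure hmF.aestronglyMeasurable hmn.aemeasurable]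
    refine hdom.mono' (hmF.comp hmn).aestronglyMeasurable (Eventually.of_forall fun x => ?_)
    simp only [Function.comp_def]
    rw [Real.norm_of_nonneg (by positivity)]
    exact hptw x
  · rw [integral_map hmn.aemeasurable hmF.aestronglyMeasurable]
    refine (integral_mono_of_nonneg (Eventually.of_forall fun x => by positivity) hdom
      (Eventually.of_forall hptw)).trans ?_
    rw [integral_add (g1.const_mul 8) (g3.const_mul (8 * C ^ 4)), integral_const_mul,
      integral_const_mul]
    have := mul_le_mul_of_nonneg_left g4 (by positivity : 0 ≤ 8 * C ^ 4)
    nlinarith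


section matrixlemmas

variable {n m : Type*} [Fintype n] [DecidableEq n] [Fintype m] [DecidableEq m]

theorem posDef_one_add {S : Matrix n n ℝ} (hS : S.PosSemidef) : (1 + S).PosDef :=
  PosDef.one.add_posSemidef hS

theorem det_unit_one_add {S : Matrix n n ℝ} (hS : S.PosSemidef) : IsUnit (1 + S).det :=
  (Matrix.isUnit_iff_isUnit_det _).1 (posDef_one_add hS).isUnit

theorem resolvent_sq_le {S : Matrix n n ℝ} (hS : S.PosSemidef) (b : n → ℝ) :
    ((1 + S)⁻¹ *ᵥ b) ⬝ᵥ ((1 + S)⁻¹ *ᵥ b) ≤ b ⬝ᵥ ((1 + S)⁻¹ *ᵥ b) := by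
  set w := (1 + S)⁻¹ *ᵥ b with hw
  have hb : b = (1 + S) *ᵥ w := by
    rw [hw, mulVec_mulVec, mul_nonsing_inv _ (det_unit_one_add hS), one_mulVec]
  have h1 : 0 ≤ w ⬝ᵥ S *ᵥ w := by
    have := hS.dotProduct_mulVec_nonneg w
    simpa using this
  rw [dotProduct_comm b, hb, add_mulVec, one_mulVec, dotProduct_add]
  linarith

theorem resolvent_diag_bounds {S : Matrix n n ℝ} (hS : S.PosSemidef) (k : n) :
    0 ≤ (1 + S)⁻¹ k k ∧ (1 + S)⁻¹ k k ≤ 1 := by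
  have h := resolvent_sq_le hS (Pi.single k 1)
  have h1 : Pi.single k 1 ⬝ᵥ ((1 + S)⁻¹ *ᵥ Pi.single k 1) = (1 + S)⁻¹ k k := by simp
  rw [h1] at h
  have h2 : ((1 + S)⁻¹ k k) ^ 2 ≤ ((1 + S)⁻¹ *ᵥ Pi.single k 1) ⬝ᵥ ((1 + S)⁻¹ *ᵥ Pi.single k 1) := by
    rw [dotProduct]
    have := Finset.single_le_sum (f := fun j => ((1 + S)⁻¹ *ᵥ Pi.single k 1) j *
      ((1 + S)⁻¹ *ᵥ Pi.single k 1) j) (fun j _ => mul_self_nonneg _) (Finset.mem_univ k)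
    have hk : ((1 + S)⁻¹ *ᵥ Pi.single k 1) k = (1 + S)⁻¹ k k := by simp
    simp only [hk] at this
    rw [sq]; exact this
  constructor <;> nlinarith

theorem sherman_morrison {S : Matrix n n ℝ} (hS : S.PosSemidef) (b : n → ℝ) :
    (1 + (S + vecMulVec b b))⁻¹ = (1 + S)⁻¹ -
      (1 + b ⬝ᵥ ((1 + S)⁻¹ *ᵥ b))⁻¹ •
        vecMulVec ((1 + S)⁻¹ *ᵥ b) ((1 + S)⁻¹ *ᵥ b) := by
  apply inv_eq_right_inv
  have hdet := det_unit_one_add hS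
  have hsymm : (1 + S)⁻¹ᵀ = (1 + S)⁻¹ := by
    rw [transpose_nonsing_inv]
    congr 1
    have := hS.1
    rw [IsHermitian, conjTranspose_eq_transpose_of_trivial] at this
    simp [this]
  have hsq := resolvent_sq_le hS b
  set R := (1 + S)⁻¹ with hR
  set w := R *ᵥ b with hw
  set α := b ⬝ᵥ w with hα
  have hpos : 1 + α ≠ 0 := by
    have : 0 ≤ w ⬝ᵥ w := Finset.sum_nonneg fun i _ => mul_self_nonneg _
    linarith
  have h1 : (1 + S) * R = 1 := mul_nonsing_inv _ hdet
  have h2 : vecMulVec b b * R = vecMulVec b w := by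
    rw [vecMulVec_mul, hw, ← mulVec_transpose, hsymm]
  have h3 : (1 + S) * vecMulVec w w = vecMulVec b w := by
    rw [mul_vecMulVec, hw, mulVec_mulVec, h1, one_mulVec]
  have h4 : vecMulVec b b * vecMulVec w w = α • vecMulVec b w := by
    rw [vecMulVec_mul_vecMulVec, ← hα, vecMulVec_smul]
  rw [← add_assoc, add_mul, mul_sub, mul_sub, mul_smul_comm, mul_smul_comm, h1, h2, h3, h4, smul_smul]
  have h5 : vecMulVec b w = ((1 + α)⁻¹ + (1 + α)⁻¹ * α) • vecMulVec b w := by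
    have : (1 + α)⁻¹ + (1 + α)⁻¹ * α = 1 := by field_simp
    rw [this, one_smul]
  rw [add_smul] at h5
  generalize (1 + α)⁻¹ • vecMulVec b w = X at *
  generalize ((1 + α)⁻¹ * α) • vecMulVec b w = Y at *
  rw [h5]
  abel

theorem rank_one_trace {S : Matrix n n ℝ} (hS : S.PosSemidef) (b d : n → ℝ) (C : ℝ)
    (hC0 : 0 ≤ C)
    (hd0 : ∀ k, 0 ≤ d k) (hdC : ∀ k, d k ≤ C) :
    ∑ k, d k * (1 + (S + vecMulVec b b))⁻¹ k k ≤ ∑ k, d k * (1 + S)⁻¹ k k ∧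
    ∑ k, d k * (1 + S)⁻¹ k k - C ≤ ∑ k, d k * (1 + (S + vecMulVec b b))⁻¹ k k := by
  rw [sherman_morrison hS b]
  have hsq := resolvent_sq_le hS b
  set w := (1 + S)⁻¹ *ᵥ b with hw
  set α := b ⬝ᵥ w with hα
  have hww : 0 ≤ w ⬝ᵥ w := Finset.sum_nonneg fun i _ => mul_self_nonneg _
  have hpos : 0 < 1 + α := by linarith
  have e : ∑ k, d k * ((1 + S)⁻¹ - (1 + α)⁻¹ • vecMulVec w w) k k =
      ∑ k, d k * (1 + S)⁻¹ k k - (1 + α)⁻¹ * ∑ k, d k * (w k * w k) := by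
    rw [Finset.mul_sum, ← Finset.sum_sub_distrib]
    refine Finset.sum_congr rfl fun k _ => ?_
    simp [vecMulVec_apply]; ring
  rw [e]
  have h1 : 0 ≤ ∑ k, d k * (w k * w k) :=
    Finset.sum_nonneg fun k _ => mul_nonneg (hd0 k) (mul_self_nonneg _)
  have h2 : ∑ k, d k * (w k * w k) ≤ C * (1 + α) := by
    have : ∑ k, d k * (w k * w k) ≤ C * (w ⬝ᵥ w) := by
      rw [dotProduct, Finset.mul_sum]
      exact Finset.sum_le_sum fun k _ => mul_le_mul_of_nonneg_right (hdC k) (mul_self_nonneg _)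
    nlinarith
  have h3 : 0 ≤ (1 + α)⁻¹ * ∑ k, d k * (w k * w k) := by positivity
  have h4 : (1 + α)⁻¹ * ∑ k, d k * (w k * w k) ≤ C := by
    rw [inv_mul_le_iff₀ hpos]; linarith
  constructor <;> linarith

theorem measurable_matrix_inv {Ω : Type*} [TopologicalSpace Ω] [MeasurableSpace Ω] [BorelSpace Ω]
    {X : Ω → Matrix n n ℝ} (hX : Continuous X) (a b : n) : Measurable fun ω => (X ω)⁻¹ a b := by
  simp only [inv_def, Ring.inverse_eq_inv', Matrix.smul_apply, smul_eq_mul]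
  have h1 : Continuous fun ω => (X ω).det := hX.matrix_det
  have h2 : Continuous fun ω => (X ω).adjugate a b := (hX.matrix_adjugate).matrix_elem a b
  exact h1.measurable.inv.mul h2.measurable

theorem tendsto_matrix_inv {X : ℕ → Matrix n n ℝ} {Y : Matrix n n ℝ}
    (hX : Tendsto X atTop (𝓝 Y)) (hY : Y.det ≠ 0) : Tendsto (fun m => (X m)⁻¹) atTop (𝓝 Y⁻¹) := by
  simp only [inv_def, Ring.inverse_eq_inv']
  have h1 : Tendsto (fun m => (X m).det) atTop (𝓝 Y.det) :=
    ((continuous_id.matrix_det).tendsto Y).comp hX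
  have h2 : Tendsto (fun m => (X m).adjugate) atTop (𝓝 Y.adjugate) :=
    ((continuous_id.matrix_adjugate).tendsto Y).comp hX
  exact (h1.inv₀ hY).smul h2

theorem push_through (B : Matrix m n ℝ) (hB : (B * Bᵀ).PosSemidef) (t : ℝ) (ht : 0 < t) :
    (1 + t • (Bᵀ * B))⁻¹ = 1 - Bᵀ * (t⁻¹ • (1 : Matrix m m ℝ) + B * Bᵀ)⁻¹ * B := by
  have hpd : (t⁻¹ • (1 : Matrix m m ℝ) + B * Bᵀ).PosDef :=
    (PosDef.one.smul (inv_pos.2 ht)).add_posSemidef hB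
  have hu : (t⁻¹ • (1 : Matrix m m ℝ) + B * Bᵀ) * (t⁻¹ • (1 : Matrix m m ℝ) + B * Bᵀ)⁻¹ = 1 :=
    mul_nonsing_inv _ ((Matrix.isUnit_iff_isUnit_det _).1 hpd.isUnit)
  apply inv_eq_right_inv
  set H := (t⁻¹ • (1 : Matrix m m ℝ) + B * Bᵀ)⁻¹
  have h1 : H + t • (B * Bᵀ * H) = t • (1 : Matrix m m ℝ) := by
    rw [← hu, add_mul, smul_add, smul_mul_assoc, one_mul, smul_smul, mul_inv_cancel₀ ht.ne', one_smul]
  have h2 : Bᵀ * (H + t • (B * Bᵀ * H)) * B = t • (Bᵀ * B) := by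
    rw [h1]; simp
  simp only [Matrix.mul_add, Matrix.add_mul, Matrix.smul_mul, Matrix.mul_smul,
    Matrix.mul_assoc] at h2
  simp only [Matrix.mul_sub, Matrix.add_mul, Matrix.smul_mul, Matrix.one_mul, Matrix.mul_one,
    Matrix.mul_assoc]
  rw [← h2]
  abel

theorem resolvent_tendsto (B : Matrix m n ℝ) (hB : (B * Bᵀ).PosSemidef) (hdet : (B * Bᵀ).det ≠ 0) :
    Tendsto (fun t : ℕ => (1 + ((t : ℝ) + 1) • (Bᵀ * B))⁻¹) atTop
      (𝓝 (1 - Bᵀ * (B * Bᵀ)⁻¹ * B)) := by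
  have e : ∀ t : ℕ, (1 + ((t : ℝ) + 1) • (Bᵀ * B))⁻¹ =
      1 - Bᵀ * (((t : ℝ) + 1)⁻¹ • (1 : Matrix m m ℝ) + B * Bᵀ)⁻¹ * B := fun t =>
    push_through B hB _ (by positivity)
  simp only [e]
  have h1 : Tendsto (fun t : ℕ => ((t : ℝ) + 1)⁻¹ • (1 : Matrix m m ℝ) + B * Bᵀ) atTop
      (𝓝 (B * Bᵀ)) := by
    have h := (tendsto_one_div_add_atTop_nhds_zero_nat (𝕜 := ℝ)).smul_const (1 : Matrix m m ℝ)
    have := h.add_const (B * Bᵀ)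
    simpa using this
  have h2 := tendsto_matrix_inv h1 hdet
  have hc : Continuous fun H : Matrix m m ℝ => 1 - Bᵀ * H * B := by fun_prop
  exact (hc.tendsto _).comp h2

theorem proj_props (B : Matrix m n ℝ) :
    (1 - Bᵀ * (B * Bᵀ)⁻¹ * B)ᵀ = 1 - Bᵀ * (B * Bᵀ)⁻¹ * B ∧
    (1 - Bᵀ * (B * Bᵀ)⁻¹ * B) * (1 - Bᵀ * (B * Bᵀ)⁻¹ * B) = 1 - Bᵀ * (B * Bᵀ)⁻¹ * B ∧
    (Fintype.card n : ℝ) - Fintype.card m ≤ (1 - Bᵀ * (B * Bᵀ)⁻¹ * B).trace := by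
  refine ⟨?_, ?_, ?_⟩
  · simp [transpose_nonsing_inv, Matrix.mul_assoc]
  · by_cases h : IsUnit (B * Bᵀ).det
    · have : Bᵀ * (B * Bᵀ)⁻¹ * B * (Bᵀ * (B * Bᵀ)⁻¹ * B) = Bᵀ * (B * Bᵀ)⁻¹ * B := by
        calc _ = Bᵀ * ((B * Bᵀ)⁻¹ * (B * Bᵀ)) * (B * Bᵀ)⁻¹ * B := by
              simp only [Matrix.mul_assoc]
          _ = _ := by rw [nonsing_inv_mul _ h, Matrix.mul_one]
      rw [mul_sub, mul_one, sub_mul, one_mul, this]; simp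
    · simp [nonsing_inv_apply_not_isUnit _ h]
  · by_cases h : IsUnit (B * Bᵀ).det
    · rw [trace_sub, trace_one, Matrix.mul_assoc, trace_mul_comm, Matrix.mul_assoc,
        nonsing_inv_mul _ h, trace_one]
    · simp [nonsing_inv_apply_not_isUnit _ h]

theorem proj_quad {P : Matrix n n ℝ} (hT : Pᵀ = P) (hP : P * P = P) (x : n → ℝ) :
    0 ≤ x ⬝ᵥ P *ᵥ x ∧ x ⬝ᵥ P *ᵥ x ≤ x ⬝ᵥ x := by
  have key : ∀ Q : Matrix n n ℝ, Qᵀ = Q → Q * Q = Q → 0 ≤ x ⬝ᵥ Q *ᵥ x := by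
    intro Q h1 h2
    have : x ⬝ᵥ Q *ᵥ x = (Q *ᵥ x) ⬝ᵥ (Q *ᵥ x) := by
      conv_lhs => rw [← h2, ← mulVec_mulVec, dotProduct_mulVec, ← mulVec_transpose, h1]
    rw [this]
    exact Finset.sum_nonneg fun i _ => mul_self_nonneg _
  refine ⟨key P hT hP, ?_⟩
  have h := key (1 - P) (by simp [hT]) (by simp [mul_sub, sub_mul, hP])
  rw [sub_mulVec, one_mulVec, dotProduct_sub] at h
  linarith

end matrixlemmas


theorem trace_diag {n : ℕ} {A : Matrix (Fin n) (Fin n) ℝ} (hA : A.IsDiag)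
    (X : Matrix (Fin n) (Fin n) ℝ) :
    trace (A * A * X) = ∑ k, (A k k) ^ 2 * X k k := by
  have h : A * A = diagonal fun k => (A k k) ^ 2 := by
    conv_lhs => rw [← hA.diagonal_diag, diagonal_mul_diagonal]
    congr 1; ext k; simp [sq]
  rw [h, trace]
  simp [diagonal_mul]

/-- regularised version of the trace. -/
noncomputable def resT {n p : ℕ} (A : Matrix (Fin n) (Fin n) ℝ) (i t : ℕ)
    (ω : Fin p → Fin n → ℝ) : ℝ :=
  ∑ k, (A k k) ^ 2 * (1 + ((t : ℝ) + 1) • ((rowMat A ω i)ᵀ * rowMat A ω i) :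
    Matrix (Fin n) (Fin n) ℝ)⁻¹ k k

theorem vecMulVec_psd {n : ℕ} (b : Fin n → ℝ) : (vecMulVec b b).PosSemidef := by
  have := posSemidef_vecMulVec_self_star b
  simpa using this

theorem gram_sum {n p : ℕ} (A : Matrix (Fin n) (Fin n) ℝ) (i : ℕ) (ω : Fin p → Fin n → ℝ) :
    (rowMat A ω i)ᵀ * rowMat A ω i =
      ∑ k : Fin i, vecMulVec (A *ᵥ uVec ω k) (A *ᵥ uVec ω k) := by
  ext a b
  rw [Matrix.mul_apply, Matrix.sum_apply]
  simp [rowMat, vecMulVec_apply]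

theorem psd_sum_vec {n : ℕ} {ι : Type*} (s : Finset ι) (b : ι → Fin n → ℝ) :
    (∑ k ∈ s, vecMulVec (b k) (b k)).PosSemidef :=
  Matrix.posSemidef_sum s fun k _ => vecMulVec_psd (b k)

theorem gram_psd {n p : ℕ} (A : Matrix (Fin n) (Fin n) ℝ) (i t : ℕ) (ω : Fin p → Fin n → ℝ) :
    (((t : ℝ) + 1) • ((rowMat A ω i)ᵀ * rowMat A ω i)).PosSemidef := by
  rw [gram_sum]
  exact (psd_sum_vec _ _).smul (by positivity)

theorem resT_bound {n p : ℕ} (A : Matrix (Fin n) (Fin n) ℝ) (i t : ℕ) (C : ℝ)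
    (hCb : ∀ k, (A k k) ^ 2 ≤ C) (ω : Fin p → Fin n → ℝ) :
    |resT A i t ω| ≤ n * C := by
  have h := fun k => resolvent_diag_bounds (gram_psd A i t ω) k
  have h0 : 0 ≤ resT A i t ω := Finset.sum_nonneg fun k _ => mul_nonneg (sq_nonneg _) (h k).1
  rw [abs_of_nonneg h0]
  calc resT A i t ω ≤ ∑ k : Fin n, C := by
        refine Finset.sum_le_sum fun k _ => ?_
        have h1 := h k
        have := hCb k
        nlinarith [sq_nonneg (A k k)]
    _ = n * C := by simp

theorem continuous_uVec {n p : ℕ} (k : ℕ) :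
    Continuous fun ω : Fin p → Fin n → ℝ => uVec ω k := by
  unfold uVec
  split_ifs with h
  · fun_prop
  · fun_prop

theorem continuous_rowMat {n p : ℕ} (A : Matrix (Fin n) (Fin n) ℝ) (i : ℕ) :
    Continuous fun ω : Fin p → Fin n → ℝ => rowMat A ω i := by
  unfold rowMat
  refine continuous_matrix fun a b => ?_
  have := continuous_uVec (n := n) (p := p) (a : ℕ)
  simp only [Matrix.of_apply]
  have h2 : Continuous fun ω : Fin p → Fin n → ℝ => A *ᵥ uVec ω a :=
    Continuous.matrix_mulVec continuous_const this
  exact (continuous_apply b).comp h2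

theorem resT_measurable {n p : ℕ} (A : Matrix (Fin n) (Fin n) ℝ) (i t : ℕ) :
    Measurable fun ω : Fin p → Fin n → ℝ => resT A i t ω := by
  unfold resT
  refine Finset.measurable_sum _ fun k _ => Measurable.const_mul ?_ _
  refine measurable_matrix_inv ?_ k k
  have := continuous_rowMat (p := p) A i
  fun_prop

theorem resT_update {n p : ℕ} (A : Matrix (Fin n) (Fin n) ℝ) (i t : ℕ) (C : ℝ) (hC : 0 ≤ C)
    (hCb : ∀ k, (A k k) ^ 2 ≤ C) (ω : Fin p → Fin n → ℝ) (j : Fin p) (y : Fin n → ℝ) :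
    |resT A i t (Function.update ω j y) - resT A i t ω| ≤ C := by
  by_cases hj : (j : ℕ) < i
  · let b : (Fin p → Fin n → ℝ) → Fin i → Fin n → ℝ := fun ω k => A *ᵥ uVec ω k
    let S0 : (Fin p → Fin n → ℝ) → Matrix (Fin n) (Fin n) ℝ := fun ω =>
      ((t : ℝ) + 1) • ∑ k ∈ Finset.univ.erase (⟨j, hj⟩ : Fin i), vecMulVec (b ω k) (b ω k)
    have hS0 : ∀ ω, (S0 ω).PosSemidef := fun ω => (psd_sum_vec _ _).smul (by positivity)
    have hSu : S0 (Function.update ω j y) = S0 ω := by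
      simp only [S0]
      congr 1
      refine Finset.sum_congr rfl fun k hk => ?_
      have hk' : (k : ℕ) ≠ j := fun h => (Finset.ne_of_mem_erase hk) (Fin.ext h)
      have : uVec (Function.update ω j y) k = uVec ω k := by
        unfold uVec
        split_ifs with h
        · rw [Function.update_of_ne]
          intro h'; exact hk' (congrArg Fin.val h')
        · rfl
      simp only [b, this]
    have hdec : ∀ ω : Fin p → Fin n → ℝ, ((t : ℝ) + 1) • ((rowMat A ω i)ᵀ * rowMat A ω i) =
        S0 ω + vecMulVec (Real.sqrt ((t : ℝ) + 1) • b ω ⟨j, hj⟩)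
          (Real.sqrt ((t : ℝ) + 1) • b ω ⟨j, hj⟩) := by
      intro ω
      rw [gram_sum, ← Finset.sum_erase_add _ _ (Finset.mem_univ (⟨j, hj⟩ : Fin i)), smul_add,
        smul_vecMulVec, vecMulVec_smul, smul_smul, Real.mul_self_sqrt (by positivity)]
    have h1 := rank_one_trace (hS0 ω) (Real.sqrt ((t : ℝ) + 1) • b ω ⟨j, hj⟩)
      (fun k => (A k k) ^ 2) C hC (fun k => sq_nonneg _) hCb
    have h2 := rank_one_trace (hS0 (Function.update ω j y))
      (Real.sqrt ((t : ℝ) + 1) • b (Function.update ω j y) ⟨j, hj⟩)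
      (fun k => (A k k) ^ 2) C hC (fun k => sq_nonneg _) hCb
    rw [← hdec] at h1 h2
    rw [hSu] at h2
    unfold resT
    rw [abs_le]
    constructor <;> linarith [h1.1, h1.2, h2.1, h2.2]
  · have : rowMat A (Function.update ω j y) i = rowMat A ω i := by
      unfold rowMat
      congr 1; ext k l
      have : uVec (Function.update ω j y) k = uVec ω k := by
        unfold uVec
        split_ifs with h
        · rw [Function.update_of_ne]
          intro h'
          have := congrArg Fin.val h'
          have hk := k.2
          simp at this; omega
        · rfl
      rw [this]
    unfold resT
    rw [this]; simpa using hC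

theorem projMat_props {n p : ℕ} (A : Matrix (Fin n) (Fin n) ℝ) (i : ℕ) (ω : Fin p → Fin n → ℝ) :
    (projMat A ω i)ᵀ = projMat A ω i ∧ projMat A ω i * projMat A ω i = projMat A ω i ∧
    (n : ℝ) - i ≤ (projMat A ω i).trace := by
  have := proj_props (rowMat A ω i)
  simpa [projMat] using this

theorem projMat_diag {n p : ℕ} (A : Matrix (Fin n) (Fin n) ℝ) (i : ℕ) (ω : Fin p → Fin n → ℝ)
    (k : Fin n) : 0 ≤ projMat A ω i k k ∧ projMat A ω i k k ≤ 1 := by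
  obtain ⟨h1, h2, _⟩ := projMat_props A i ω
  have := proj_quad h1 h2 (Pi.single k 1)
  simpa using this

theorem projMat_measurable {n p : ℕ} (A : Matrix (Fin n) (Fin n) ℝ) (i : ℕ) (k l : Fin n) :
    Measurable fun ω : Fin p → Fin n → ℝ => projMat A ω i k l := by
  have hc := continuous_rowMat (p := p) A i
  have he : ∀ a b, Measurable fun ω : Fin p → Fin n → ℝ => rowMat A ω i a b := fun a b =>
    (hc.matrix_elem a b).measurable
  have hinv : ∀ a b, Measurable fun ω : Fin p → Fin n → ℝ =>
      (rowMat A ω i * (rowMat A ω i)ᵀ)⁻¹ a b := fun a b =>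
    measurable_matrix_inv (by fun_prop) a b
  simp only [projMat, Matrix.sub_apply, Matrix.mul_apply, Matrix.transpose_apply] at *
  refine measurable_const.sub (Finset.measurable_sum _ fun b _ => Measurable.mul ?_ (he _ _))
  exact Finset.measurable_sum _ fun a _ => (he _ _).mul (hinv _ _)

/-- the trace functional. -/
noncomputable def projT {n p : ℕ} (A : Matrix (Fin n) (Fin n) ℝ) (i : ℕ)
    (ω : Fin p → Fin n → ℝ) : ℝ :=
  ∑ k, (A k k) ^ 2 * projMat A ω i k k

theorem projT_measurable {n p : ℕ} (A : Matrix (Fin n) (Fin n) ℝ) (i : ℕ) :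
    Measurable fun ω : Fin p → Fin n → ℝ => projT A i ω :=
  Finset.measurable_sum _ fun k _ => (projMat_measurable A i k k).const_mul _

theorem projT_bound {n p : ℕ} (A : Matrix (Fin n) (Fin n) ℝ) (i : ℕ) (C : ℝ)
    (hCb : ∀ k, (A k k) ^ 2 ≤ C) (ω : Fin p → Fin n → ℝ) :
    |projT A i ω| ≤ n * C := by
  have h := fun k => projMat_diag A i ω k
  have h0 : 0 ≤ projT A i ω := Finset.sum_nonneg fun k _ => mul_nonneg (sq_nonneg _) (h k).1
  rw [abs_of_nonneg h0]
  calc projT A i ω ≤ ∑ k : Fin n, C := by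
        refine Finset.sum_le_sum fun k _ => ?_
        have h1 := h k
        have := hCb k
        nlinarith [sq_nonneg (A k k)]
    _ = n * C := by simp

theorem projT_lower {n p : ℕ} (A : Matrix (Fin n) (Fin n) ℝ) (i : ℕ) (c : ℝ) (hc : 0 ≤ c)
    (hcb : ∀ k, c ≤ (A k k) ^ 2) (ω : Fin p → Fin n → ℝ) :
    c * (n - i) ≤ projT A i ω := by
  have h := fun k => projMat_diag A i ω k
  have ht := (projMat_props A i ω).2.2
  calc c * (n - i) ≤ c * (projMat A ω i).trace := mul_le_mul_of_nonneg_left ht hc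
    _ = ∑ k, c * projMat A ω i k k := by rw [trace, Finset.mul_sum]; rfl
    _ ≤ _ := Finset.sum_le_sum fun k _ => mul_le_mul_of_nonneg_right (hcb k) (h k).1

theorem Tstat_eq {n p : ℕ} {A : Matrix (Fin n) (Fin n) ℝ} (hA : A.IsDiag) (i : ℕ) :
    Tstat n p A i = ∫ ω, projT A i ω ∂(sphereLaw n p) := by
  unfold Tstat projT
  rw [trace_diag hA, integral_finsetSum]
  · refine Finset.sum_congr rfl fun k _ => ?_
    rw [integral_const_mul]; rfl
  · intro k _
    refine Integrable.const_mul ?_ _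
    refine integrable_of_bdd (K := 1) (projMat_measurable A i k k) fun ω => ?_
    have := projMat_diag A i ω k
    rw [abs_le]; constructor <;> linarith

theorem rowMat_det {n p : ℕ} {A : Matrix (Fin n) (Fin n) ℝ} (hA : A.IsDiag)
    (hpos : ∀ k, 0 < A k k) (i : ℕ) (hi : i ≤ p) (ω : Fin p → Fin n → ℝ)
    (hω : LinearIndependent ℝ ω) : (rowMat A ω i * (rowMat A ω i)ᵀ).det ≠ 0 := by
  have hinj : Function.Injective (A *ᵥ ·) := by
    rw [Matrix.mulVec_injective_iff_isUnit, Matrix.isUnit_iff_isUnit_det, ← hA.diagonal_diag, det_diagonal]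
    exact isUnit_iff_ne_zero.2 (Finset.prod_ne_zero_iff.2 fun k _ => (hpos k).ne')
  have h1 : LinearIndependent ℝ (rowMat A ω i).row := by
    have e : (rowMat A ω i).row = (Matrix.mulVecLin A) ∘ (ω ∘ Fin.castLE hi) := by
      ext k l
      have : (k : ℕ) < p := lt_of_lt_of_le k.2 hi
      simp [rowMat, uVec, this]
      rfl
    rw [e]
    refine (hω.comp _ (Fin.castLE_injective hi)).map' _ ?_
    rw [LinearMap.ker_eq_bot]; exact hinj
  have h2 : (rowMat A ω i * (rowMat A ω i)ᵀ).PosDef := by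
    have := Matrix.PosDef.mul_conjTranspose_self (rowMat A ω i) (Matrix.vecMul_injective_iff.2 h1)
    simpa using this
  exact h2.det_pos.ne'

theorem resT_tendsto {n p : ℕ} {A : Matrix (Fin n) (Fin n) ℝ} (hA : A.IsDiag)
    (hpos : ∀ k, 0 < A k k) (i : ℕ) (hi : i ≤ p) (ω : Fin p → Fin n → ℝ)
    (hω : LinearIndependent ℝ ω) :
    Tendsto (fun t => resT A i t ω) atTop (𝓝 (projT A i ω)) := by
  have hd := rowMat_det hA hpos i hi ω hω
  have hps : (rowMat A ω i * (rowMat A ω i)ᵀ).PosSemidef := by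
    have := Matrix.posSemidef_self_mul_conjTranspose (rowMat A ω i)
    simpa using this
  have := resolvent_tendsto (rowMat A ω i) hps hd
  unfold resT projT
  refine tendsto_finsetSum _ fun k _ => Tendsto.const_mul _ ?_
  exact (((continuous_id.matrix_elem k k).tendsto _).comp this)

theorem projT_fourth {n p : ℕ} (hp : p ≤ n) {A : Matrix (Fin n) (Fin n) ℝ} (hA : A.IsDiag)
    (hpos : ∀ k, 0 < A k k) (C : ℝ) (hC : 0 ≤ C) (hCb : ∀ k, (A k k) ^ 2 ≤ C) (i : ℕ) (hi : i ≤ p) :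
    ∫ ω, (projT A i ω - Tstat n p A i) ^ 4 ∂(sphereLaw n p) ≤ 4 * C ^ 4 * n ^ 2 := by
  have hae := sphereLaw_linInd n p hp
  have hb : ∀ t, ∫ ω, (resT A i t ω - ∫ ω, resT A i t ω ∂(sphereLaw n p)) ^ 4 ∂(sphereLaw n p)
      ≤ 4 * C ^ 4 * n ^ 2 := by
    intro t
    have h := (bd_moments (uniformSphere n) C p (fun ω => resT A i t ω) (resT_measurable A i t)
      (n * C) (resT_bound A i t C hCb) (fun x j y => resT_update A i t C hC hCb x j y)).2
    refine h.trans ?_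
    have : (p : ℝ) ^ 2 ≤ (n : ℝ) ^ 2 := by gcongr
    exact mul_le_mul_of_nonneg_left this (by positivity)
  have hm : Tendsto (fun t => ∫ ω, resT A i t ω ∂(sphereLaw n p)) atTop (𝓝 (Tstat n p A i)) := by
    rw [Tstat_eq hA]
    refine tendsto_integral_of_dominated_convergence (fun _ => n * C)
      (fun t => (resT_measurable A i t).aestronglyMeasurable) (integrable_const _)
      (fun t => Eventually.of_forall fun ω => resT_bound A i t C hCb ω) ?_
    filter_upwards [hae] with ω hω using resT_tendsto hA hpos i hi ω hω
  have hmb : ∀ t, |∫ ω, resT A i t ω ∂(sphereLaw n p)| ≤ n * C := by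
    intro t
    have := norm_integral_le_of_norm_le_const (μ := sphereLaw n p) (f := fun ω => resT A i t ω)
      (C := n * C) (Eventually.of_forall fun ω => resT_bound A i t C hCb ω)
    simpa using this
  refine le_of_tendsto' (f := fun t => ∫ ω, (resT A i t ω - ∫ ω, resT A i t ω ∂(sphereLaw n p)) ^ 4
    ∂(sphereLaw n p)) (x := atTop) ?_ hb
  refine tendsto_integral_of_dominated_convergence (fun _ => (2 * (n * C)) ^ 4)
      (fun t => (((resT_measurable A i t).sub_const _).pow_const 4).aestronglyMeasurable)
      (integrable_const _) (fun t => Eventually.of_forall fun ω => ?_) ?_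
  · rw [norm_pow, Real.norm_eq_abs]
    have h1 := resT_bound A i t C hCb ω
    have h2 := hmb t
    have := abs_sub (resT A i t ω) (∫ ω, resT A i t ω ∂(sphereLaw n p))
    gcongr
    linarith
  · filter_upwards [hae] with ω hω using ((resT_tendsto hA hpos i hi ω hω).sub hm).pow 4


theorem pi_fubini {E : Type*} [MeasurableSpace E] (μ : Measure E) [IsProbabilityMeasure μ]
    (p : ℕ) (i : Fin p) (F H : (Fin p → E) → ℝ) (c : ℝ) (hc : 0 ≤ c) (hF : ∀ ω, 0 ≤ F ω)
    (hH0 : ∀ ω, 0 ≤ H ω)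
    (hH : Integrable H (Measure.pi fun _ : Fin p => μ))
    (hHi : ∀ ω y, H (Function.update ω i y) = H ω)
    (hFH : ∀ ω, ∫ u, F (Function.update ω i u) ∂μ ≤ c + H ω) :
    ∫ ω, F ω ∂(Measure.pi fun _ : Fin p => μ) ≤ c + ∫ ω, H ω ∂(Measure.pi fun _ : Fin p => μ) := by
  by_cases hint : Integrable F (Measure.pi fun _ : Fin p => μ)
  swap
  · rw [integral_undef hint]
    exact add_nonneg hc (integral_nonneg hH0)
  obtain ⟨y0⟩ : Nonempty E := by
    by_contra h
    rw [not_nonempty_iff] at h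
    have := measure_univ (μ := μ)
    simp [Measure.eq_zero_of_isEmpty μ] at this
  cases p with
  | zero => exact i.elim0
  | succ q =>
    have hmp := measurePreserving_piFinSuccAbove (fun _ : Fin (q+1) => μ) i
    set e := MeasurableEquiv.piFinSuccAbove (fun _ : Fin (q+1) => E) i
    have hs := hmp.symm
    have he : ∀ u x, e.symm (u, x) = Function.update (e.symm (y0, x)) i u := by
      intro u x
      have h1 : ∀ v, e.symm (v, x) = Fin.insertNth i v x := by
        intro v
        rfl
      rw [h1, h1]
      simp
    have hi1 : Integrable (fun z => F (e.symm z)) (μ.prod (Measure.pi fun _ : Fin q => μ)) :=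
      (hs.integrable_comp_emb e.symm.measurableEmbedding).2 hint
    have hi2 : Integrable (fun z => H (e.symm z)) (μ.prod (Measure.pi fun _ : Fin q => μ)) :=
      (hs.integrable_comp_emb e.symm.measurableEmbedding).2 hH
    have eF : ∫ ω, F ω ∂(Measure.pi fun _ : Fin (q+1) => μ) =
        ∫ x, ∫ u, F (e.symm (u, x)) ∂μ ∂(Measure.pi fun _ : Fin q => μ) := by
      rw [← hs.integral_comp e.symm.measurableEmbedding, integral_prod_symm _ hi1]
    have eH : ∫ ω, H ω ∂(Measure.pi fun _ : Fin (q+1) => μ) =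
        ∫ x, ∫ u, H (e.symm (u, x)) ∂μ ∂(Measure.pi fun _ : Fin q => μ) := by
      rw [← hs.integral_comp e.symm.measurableEmbedding, integral_prod_symm _ hi2]
    have hHc : ∀ x, ∫ u, H (e.symm (u, x)) ∂μ = H (e.symm (y0, x)) := by
      intro x
      have : ∀ u, H (e.symm (u, x)) = H (e.symm (y0, x)) := fun u => by rw [he, hHi]
      simp [this]
    have hi3 := hi2.integral_prod_right
    simp only [hHc] at hi3 eH
    rw [eF, eH]
    have : c + ∫ x, H (e.symm (y0, x)) ∂(Measure.pi fun _ : Fin q => μ) =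
        ∫ x, (c + H (e.symm (y0, x))) ∂(Measure.pi fun _ : Fin q => μ) := by
      rw [integral_add (integrable_const _) hi3]; simp
    rw [this]
    refine integral_mono hi1.integral_prod_right ((integrable_const _).add hi3) fun x => ?_
    have h := hFH (e.symm (y0, x))
    simp only [← he] at h
    exact h

theorem projMat_update {n p : ℕ} (A : Matrix (Fin n) (Fin n) ℝ) (i : ℕ) (hi : i < p)
    (ω : Fin p → Fin n → ℝ) (y : Fin n → ℝ) :
    projMat A (Function.update ω ⟨i, hi⟩ y) i = projMat A ω i := by
  have : rowMat A (Function.update ω ⟨i, hi⟩ y) i = rowMat A ω i := by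
    unfold rowMat
    congr 1; ext k l
    have : uVec (Function.update ω ⟨i, hi⟩ y) k = uVec ω k := by
      unfold uVec
      split_ifs with h
      · rw [Function.update_of_ne]
        intro h'
        have := congrArg Fin.val h'
        have hk := k.2
        simp at this; omega
      · rfl
    rw [this]
  unfold projMat
  rw [this]

theorem APA_props {n p : ℕ} {A : Matrix (Fin n) (Fin n) ℝ} (hA : A.IsDiag) (C : ℝ)
    (hCb : ∀ k, (A k k) ^ 2 ≤ C) (i : ℕ) (ω : Fin p → Fin n → ℝ) :
    (A * projMat A ω i * A).IsHermitian ∧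
    (∀ x, 0 ≤ x ⬝ᵥ (A * projMat A ω i * A) *ᵥ x) ∧
    (∀ x, x ⬝ᵥ (A * projMat A ω i * A) *ᵥ x ≤ C * (x ⬝ᵥ x)) ∧
    (A * projMat A ω i * A).trace = projT A i ω := by
  obtain ⟨h1, h2, _⟩ := projMat_props A i ω
  have hAT : Aᵀ = A := by
    rw [← hA.diagonal_diag, diagonal_transpose]
  have hq : ∀ x, x ⬝ᵥ (A * projMat A ω i * A) *ᵥ x = (A *ᵥ x) ⬝ᵥ projMat A ω i *ᵥ (A *ᵥ x) := by
    intro x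
    rw [← mulVec_mulVec, ← mulVec_mulVec, dotProduct_mulVec, ← mulVec_transpose, hAT]
  have hAx : ∀ x, (A *ᵥ x) ⬝ᵥ (A *ᵥ x) ≤ C * (x ⬝ᵥ x) := by
    intro x
    have : ∀ k, (A *ᵥ x) k = A k k * x k := by
      intro k
      conv_lhs => rw [← hA.diagonal_diag, mulVec_diagonal]
      rfl
    simp only [dotProduct, this]
    rw [Finset.mul_sum]
    refine Finset.sum_le_sum fun k _ => ?_
    have := mul_le_mul_of_nonneg_right (hCb k) (mul_self_nonneg (x k))
    nlinarith
  refine ⟨?_, fun x => ?_, fun x => ?_, ?_⟩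
  · rw [IsHermitian, conjTranspose_eq_transpose_of_trivial]
    simp [transpose_mul, hAT, h1, Matrix.mul_assoc]
  · rw [hq]; exact (proj_quad h1 h2 _).1
  · rw [hq]; exact (proj_quad h1 h2 _).2.trans (hAx x)
  · rw [projT, ← trace_diag hA, trace_mul_comm, ← Matrix.mul_assoc]

theorem Ztil_eq {n p : ℕ} {A : Matrix (Fin n) (Fin n) ℝ} (i : ℕ) (ω : Fin p → Fin n → ℝ)
    (hT : Tstat n p A i ≠ 0) :
    Ztil A ω i = (Tstat n p A i)⁻¹ * ((n : ℝ) * (uVec ω i ⬝ᵥ (A * projMat A ω i * A) *ᵥ uVec ω i)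
      - Tstat n p A i) := by
  unfold Ztil Qmat
  rw [smul_mulVec, dotProduct_smul, smul_eq_mul]
  field_simp

theorem main_bound : ∃ K : ℝ, 0 ≤ K ∧ ∀ (n p : ℕ), p ≤ n → ∀ (A : Matrix (Fin n) (Fin n) ℝ),
    A.IsDiag → (∀ k, 0 < A k k) → ∀ C : ℝ, 0 ≤ C → (∀ k, (A k k) ^ 2 ≤ C) → ∀ i < p,
    0 < Tstat n p A i →
    ∫ ω, (Ztil A ω i) ^ 4 ∂(sphereLaw n p) ≤ (Tstat n p A i)⁻¹ ^ 4 * (K * C ^ 4 * n ^ 2) := by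
  obtain ⟨K, hK, hKs⟩ := sphere_quad
  refine ⟨8 * K + 32, by positivity, ?_⟩
  intro n p hp A hA hpos C hC hCb i hi hT
  set T := Tstat n p A i with hTdef
  have hfour := projT_fourth hp hA hpos C hC hCb i hi.le
  have hint4 : Integrable (fun ω : Fin p → Fin n → ℝ => 8 * T⁻¹ ^ 4 * (projT A i ω - T) ^ 4)
      (Measure.pi fun _ : Fin p => uniformSphere n) := by
    refine Integrable.const_mul ?_ _
    refine integrable_of_bdd (K := (n * C + |T|) ^ 4) (((projT_measurable A i).sub_const _).pow_const 4)
      fun ω => ?_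
    rw [abs_pow]
    have h1 := projT_bound A i C hCb ω
    have := abs_sub (projT A i ω) T
    gcongr
    linarith
  have key := pi_fubini (uniformSphere n) p ⟨i, hi⟩ (fun ω => (Ztil A ω i) ^ 4)
    (fun ω => 8 * T⁻¹ ^ 4 * (projT A i ω - T) ^ 4) (8 * T⁻¹ ^ 4 * (K * C ^ 4 * n ^ 2))
    (by positivity) (fun ω => by positivity) (fun ω => by positivity) hint4
    (fun ω y => by simp only [projT, projMat_update]) ?_
  · change ∫ ω, (Ztil A ω i) ^ 4 ∂(sphereLaw n p) ≤ _ at key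
    refine key.trans ?_
    rw [integral_const_mul]
    change _ + 8 * T⁻¹ ^ 4 * ∫ ω, (projT A i ω - T) ^ 4 ∂(sphereLaw n p) ≤ _
    have : 8 * T⁻¹ ^ 4 * ∫ ω, (projT A i ω - T) ^ 4 ∂(sphereLaw n p) ≤
        8 * T⁻¹ ^ 4 * (4 * C ^ 4 * n ^ 2) := mul_le_mul_of_nonneg_left hfour (by positivity)
    refine (add_le_add_right this _).trans (le_of_eq ?_)
    ring
  · intro ω
    obtain ⟨a1, a2, a3, a4⟩ := APA_props hA C hCb i ω
    obtain ⟨hI, hle⟩ := hKs n _ a1 C a2 a3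
    rw [a4] at hI hle
    have hb : ∀ u, (Ztil A (Function.update ω ⟨i, hi⟩ u) i) ^ 4 ≤
        8 * T⁻¹ ^ 4 * ((n : ℝ) * (u ⬝ᵥ (A * projMat A ω i * A) *ᵥ u) - projT A i ω) ^ 4 +
        8 * T⁻¹ ^ 4 * (projT A i ω - T) ^ 4 := by
      intro u
      rw [Ztil_eq i _ hT.ne', projMat_update, ← hTdef]
      have : uVec (Function.update ω ⟨i, hi⟩ u) i = u := by simp [uVec, hi]
      rw [this, mul_pow]
      generalize (n : ℝ) * (u ⬝ᵥ (A * projMat A ω i * A) *ᵥ u) = a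
      have h4 : (a - T) ^ 4 ≤ 8 * (a - projT A i ω) ^ 4 + 8 * (projT A i ω - T) ^ 4 := by
        have e : a - T = (a - projT A i ω) + (projT A i ω - T) := by ring
        rw [e]
        generalize a - projT A i ω = x
        generalize projT A i ω - T = y
        nlinarith [sq_nonneg (x ^ 2 - y ^ 2), sq_nonneg (x - y), sq_nonneg ((x-y)^2),
          sq_nonneg ((x - y) * (x + y)), mul_nonneg (sq_nonneg (x - y)) (sq_nonneg (x + y)),
          mul_nonneg (sq_nonneg (x - y)) (sq_nonneg x), mul_nonneg (sq_nonneg (x - y)) (sq_nonneg y)]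
      have := mul_le_mul_of_nonneg_left h4 (show 0 ≤ T⁻¹ ^ 4 by positivity)
      linarith
    calc _ ≤ ∫ u, (8 * T⁻¹ ^ 4 * ((n : ℝ) * (u ⬝ᵥ (A * projMat A ω i * A) *ᵥ u) - projT A i ω) ^ 4 +
        8 * T⁻¹ ^ 4 * (projT A i ω - T) ^ 4) ∂(uniformSphere n) :=
          integral_mono_of_nonneg (Eventually.of_forall fun u => by positivity)
            ((hI.const_mul _).add (integrable_const _)) (Eventually.of_forall hb)
      _ = 8 * T⁻¹ ^ 4 * (∫ u, ((n : ℝ) * (u ⬝ᵥ (A * projMat A ω i * A) *ᵥ u) - projT A i ω) ^ 4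
            ∂(uniformSphere n)) + 8 * T⁻¹ ^ 4 * (projT A i ω - T) ^ 4 := by
          rw [integral_add (hI.const_mul _) (integrable_const _), integral_const_mul]; simp
      _ ≤ _ := by
          have := mul_le_mul_of_nonneg_left hle (show 0 ≤ 8 * T⁻¹ ^ 4 by positivity)
          linarith

theorem Tstat_lower {n p : ℕ} {A : Matrix (Fin n) (Fin n) ℝ} (hA : A.IsDiag) (C c : ℝ) (hc : 0 ≤ c)
    (hcb : ∀ k, c ≤ (A k k) ^ 2) (hCb : ∀ k, (A k k) ^ 2 ≤ C) (i : ℕ) :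
    c * (n - i) ≤ Tstat n p A i := by
  rw [Tstat_eq hA]
  have hI : Integrable (fun ω : Fin p → Fin n → ℝ => projT A i ω) (sphereLaw n p) :=
    integrable_of_bdd (projT_measurable A i) (projT_bound A i C hCb)
  have := integral_mono (integrable_const (c * ((n : ℝ) - i))) hI (projT_lower A i c hc hcb)
  simpa using this

/-- Under Assumption (A) (`p/n → γ ∈ (0,1)`) and the bound
`C⁻¹ ≤ A_{kk}² ≤ C`, there is a constant `c₀ ∈ (0,∞)` such that
`E[Z̃_{i+1}⁴] ≤ c₀ n⁻²` for all `0 ≤ i ≤ p−1` and all sufficiently large `n`. -/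
theorem fourthMoment_Ztil (p : ℕ → ℕ) (γ : ℝ) (A : ∀ n, Matrix (Fin n) (Fin n) ℝ)
    (hp : ∀ n, p n ≤ n)
    (hdiag : ∀ n, (A n).IsDiag) (hpos : ∀ n k, 0 < A n k k)
    (htr : ∀ n, Matrix.trace (A n * A n) = (n : ℝ))
    (hγ : 0 < γ ∧ γ < 1)
    (hA : Tendsto (fun n => (p n : ℝ) / (n : ℝ)) atTop (𝓝 γ))
    (C : ℝ) (hC : 1 ≤ C)
    (hCb : ∀ n k, C⁻¹ ≤ (A n k k) ^ 2 ∧ (A n k k) ^ 2 ≤ C) :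
    ∃ c₀ : ℝ, 0 < c₀ ∧ ∃ N : ℕ, ∀ n ≥ N, ∀ i < p n,
      (∫ ω, (Ztil (A n) ω i) ^ 4 ∂(sphereLaw n (p n))) ≤ c₀ / (n : ℝ) ^ 2 := by
  obtain ⟨K, hK, hmain⟩ := main_bound
  have hC0 : 0 < C := by linarith
  have h1γ : 0 < 1 - γ := by linarith [hγ.2]
  refine ⟨(2 * C / (1 - γ)) ^ 4 * (K * C ^ 4) + 1, by positivity, ?_⟩
  have hev : ∀ᶠ n in atTop, (p n : ℝ) / (n : ℝ) < (1 + γ) / 2 :=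
    hA.eventually_lt_const (by linarith [hγ.2])
  obtain ⟨N, hN⟩ := eventually_atTop.1 hev
  refine ⟨max N 1, fun n hn i hi => ?_⟩
  have hnN := hN n (le_trans (le_max_left _ _) hn)
  have hn1 : 1 ≤ n := le_trans (le_max_right _ _) hn
  have hn0 : (0 : ℝ) < n := by exact_mod_cast hn1
  rw [div_lt_iff₀ hn0] at hnN
  have hT := Tstat_lower (p := p n) (hdiag n) C C⁻¹ (by positivity) (fun k => (hCb n k).1)
    (fun k => (hCb n k).2) i
  have hip : (i : ℝ) ≤ p n := by exact_mod_cast hi.le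
  have hT2 : C⁻¹ * (n * ((1 - γ) / 2)) ≤ Tstat n (p n) (A n) i := by
    refine le_trans (mul_le_mul_of_nonneg_left ?_ (by positivity)) hT
    nlinarith
  have hpos2 : 0 < C⁻¹ * (n * ((1 - γ) / 2)) := by positivity
  have hTpos := lt_of_lt_of_le hpos2 hT2
  have h := hmain n (p n) (hp n) (A n) (hdiag n) (hpos n) C hC0.le (fun k => (hCb n k).2) i hi hTpos
  refine h.trans ?_
  have hinv : (Tstat n (p n) (A n) i)⁻¹ ≤ (2 * C / (1 - γ)) / n := by
    refine (inv_anti₀ hpos2 hT2).trans (le_of_eq ?_)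
    field_simp
  have h4 : (Tstat n (p n) (A n) i)⁻¹ ^ 4 ≤ ((2 * C / (1 - γ)) / n) ^ 4 :=
    pow_le_pow_left₀ (inv_nonneg.2 hTpos.le) hinv 4
  calc _ ≤ ((2 * C / (1 - γ)) / n) ^ 4 * (K * C ^ 4 * n ^ 2) :=
        mul_le_mul_of_nonneg_right h4 (by positivity)
    _ = ((2 * C / (1 - γ)) ^ 4 * (K * C ^ 4)) / (n : ℝ) ^ 2 := by
        rw [div_pow]; field_simp
    _ ≤ _ := by gcongr; linarith
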